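/- Let (μ_k)_{k ≥ R} be a positive, square-summable, slowly varying sequence (meaning μ_k/μ_{k+1} ∈ [1/C, C] for a fixed C) with ∑_k μ_k² ≤ 1. Then there exists an increasing C^∞ function ρ : [R, ∞) → [1, 2] such that ρ'(r) ≳ μ_k² and |ρ^{(j)}(r)| ≲_j μ_k² for all j ≥ 2 and all r ∈ [k, k+1]. -/

import Mathlib

/-- A sequence of reals extends to a smooth function on the line which on each `[k, k + 1]`, `R ≤ k`,
interpolates between the `k`-th and `(k + 1)`-st values through `Real.smoothTransition`. -/
theorem exists_contDiff_smoothTransition_interpolation (a : ℕ → ℝ) (R : ℕ) :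
    ∃ w : ℝ → ℝ, ContDiff ℝ (⊤ : ℕ∞) w ∧ ∀ k : ℕ, R ≤ k → ∀ r ∈ Set.Icc (k : ℝ) ((k : ℝ) + 1),
      w r = a k + (a (k + 1) - a k) * Real.smoothTransition (r - k) := by
  set d : ℕ → ℝ := fun i => if R ≤ i then a (i + 1) - a i else 0
  set F : ℕ → ℝ → ℝ := fun N r =>
    a R + ∑ i ∈ Finset.range N, d i * Real.smoothTransition (r - i) with hF
  have F_eq : ∀ (N M : ℕ) (r : ℝ), N ≤ M → r ≤ N → F M r = F N r := by
    intro N M r hNM hr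
    induction M, hNM using Nat.le_induction with
    | base => rfl
    | succ M hM ih =>
      have hM' : (N : ℝ) ≤ M := by exact_mod_cast hM
      rw [← ih]
      simp only [hF, Finset.sum_range_succ]
      rw [Real.smoothTransition.zero_of_nonpos (x := r - M) (by linarith)]
      ring
  have w_eq : ∀ (N : ℕ) (r : ℝ), r ≤ N → F ⌈r⌉₊ r = F N r := fun N r hr =>
    (F_eq _ _ _ (Nat.ceil_le.2 hr) (Nat.le_ceil r)).symm
  refine ⟨fun r => F ⌈r⌉₊ r, ?_, ?_⟩
  · rw [contDiff_iff_contDiffAt]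
    intro r
    obtain ⟨N, hN⟩ := exists_nat_gt r
    have hFN : ContDiff ℝ (⊤ : ℕ∞) (F N) :=
      contDiff_const.add <| ContDiff.sum fun i _ => contDiff_const.mul
        (Real.smoothTransition.contDiff.comp (contDiff_id.sub contDiff_const))
    refine hFN.contDiffAt.congr_of_eventuallyEq ?_
    filter_upwards [Iio_mem_nhds hN] with x hx using w_eq N x (le_of_lt hx)
  · intro k hk r hr
    have hsum : a R + ∑ i ∈ Finset.range k, d i * Real.smoothTransition (r - i) = a k := by
      have h1 : ∀ i ∈ Finset.range k, d i * Real.smoothTransition (r - i) = d i := by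
        intro i hi
        have : (i : ℝ) + 1 ≤ k := by exact_mod_cast Finset.mem_range.1 hi
        rw [Real.smoothTransition.one_of_one_le (by linarith [hr.1]), mul_one]
      rw [Finset.sum_congr rfl h1]
      clear h1 hr
      induction k, hk using Nat.le_induction with
      | base =>
        rw [Finset.sum_eq_zero, add_zero]
        intro i hi
        simp [Finset.mem_range.1 hi]
      | succ k hk ih =>
        rw [Finset.sum_range_succ, ← add_assoc, ih]
        simp [hk]
    have h2 := w_eq (k + 1) r (by push_cast; exact hr.2)
    refine h2.trans ?_
    simp only [hF]
    rw [Finset.sum_range_succ, ← add_assoc, hsum]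
    simp [d, hk]

/-- Each derivative of `Real.smoothTransition` is bounded on the unit interval. -/
theorem exists_bound_iteratedDeriv_smoothTransition (j : ℕ) :
    ∃ M : ℝ, 0 < M ∧ ∀ x ∈ Set.Icc (0 : ℝ) 1, |iteratedDeriv j Real.smoothTransition x| ≤ M := by
  have hc : Continuous (iteratedDeriv j Real.smoothTransition) :=
    (Real.smoothTransition.contDiff (n := (⊤ : ℕ∞))).continuous_iteratedDeriv j
      (by exact_mod_cast le_top)
  obtain ⟨M, hM⟩ := isCompact_Icc.exists_bound_of_continuousOn (s := Set.Icc (0 : ℝ) 1)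
    hc.continuousOn
  exact ⟨max M 1, by positivity, fun x hx => (hM x hx).trans (le_max_left _ _)⟩

/-- A derivative bound for a smooth function that agrees on `[k, k + 1]` with an affine image of
`Real.smoothTransition`. -/
theorem abs_iteratedDeriv_le_of_eq_smoothTransition {w : ℝ → ℝ} (hw : ContDiff ℝ (⊤ : ℕ∞) w)
    {k α β M : ℝ} {j : ℕ} (hj : 1 ≤ j)
    (hM : ∀ x ∈ Set.Icc (0 : ℝ) 1, |iteratedDeriv j Real.smoothTransition x| ≤ M)
    (h : ∀ r ∈ Set.Icc k (k + 1), w r = α + β * Real.smoothTransition (r - k)) :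
    ∀ r ∈ Set.Icc k (k + 1), |iteratedDeriv j w r| ≤ |β| * M := by
  have hc : Continuous (iteratedDeriv j w) :=
    hw.continuous_iteratedDeriv j (by exact_mod_cast le_top)
  have hclosed : IsClosed {r | |iteratedDeriv j w r| ≤ |β| * M} :=
    isClosed_le hc.abs continuous_const
  have hsub : Set.Ioo k (k + 1) ⊆ {r | |iteratedDeriv j w r| ≤ |β| * M} := by
    intro r hr
    have heq : w =ᶠ[nhds r] fun r => α + β * Real.smoothTransition (r - k) := by
      filter_upwards [Ioo_mem_nhds hr.1 hr.2] with x hx using h x ⟨hx.1.le, hx.2.le⟩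
    have hval : iteratedDeriv j w r = β * iteratedDeriv j Real.smoothTransition (r - k) := by
      rw [heq.iteratedDeriv_eq, iteratedDeriv_const_add (by omega),
        iteratedDeriv_const_mul_field, iteratedDeriv_comp_sub_const]
    simp only [Set.mem_ofPred_eq, hval, abs_mul]
    exact mul_le_mul_of_nonneg_left (hM _ ⟨by linarith [hr.1], by linarith [hr.2]⟩) (abs_nonneg β)
  have := closure_minimal hsub hclosed
  rwa [closure_Ioo (by linarith)] at this

/-- **Slowly varying radial weight.** Given a positive, square-summable, slowly varying
sequence `(μ_k)_{k ≥ R}` (`μ_k/μ_{k+1} ∈ [1/C, C]`) with `∑ μ_k² ≤ 1`, there is an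
increasing smooth `ρ : [R,∞) → [1,2]` with `ρ'(r) ≳ μ_k²` and `|ρ^{(j)}(r)| ≲_j μ_k²`
for `j ≥ 2` and `r ∈ [k, k+1]`; the implicit constants depend only on `C` and `j`. -/
theorem stmt_8 (C : ℝ) (hC : 1 ≤ C) :
    ∃ (c : ℝ) (Cj : ℕ → ℝ), 0 < c ∧ (∀ j, 0 < Cj j) ∧
      ∀ (R : ℕ) (μ : ℕ → ℝ),
        (∀ k, R ≤ k → 0 < μ k) →
        (∀ k, R ≤ k → μ k / μ (k + 1) ∈ Set.Icc (1 / C) C) →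
        Summable (fun k : ℕ => μ k ^ 2) →
        (∑' k : ℕ, μ k ^ 2) ≤ 1 →
        ∃ ρ : ℝ → ℝ,
          ContDiff ℝ (⊤ : ℕ∞) ρ ∧
          StrictMonoOn ρ (Set.Ici (R : ℝ)) ∧
          (∀ r : ℝ, (R : ℝ) ≤ r → ρ r ∈ Set.Icc (1 : ℝ) 2) ∧
          (∀ k : ℕ, R ≤ k → ∀ r ∈ Set.Icc (k : ℝ) ((k : ℝ) + 1),
            c * μ k ^ 2 ≤ deriv ρ r ∧
              ∀ j : ℕ, 2 ≤ j → |iteratedDeriv j ρ r| ≤ Cj j * μ k ^ 2) := by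
  choose M hM0 hM using exists_bound_iteratedDeriv_smoothTransition
  have hC0 : 0 < C := by linarith
  refine ⟨1 / (2 * C ^ 2), fun j => (C ^ 2 + 1) * M (j - 1), by positivity,
    fun j => mul_pos (by positivity) (hM0 _), ?_⟩
  intro R μ hμ hratio hs hs1
  obtain ⟨w, hw, hwk⟩ := exists_contDiff_smoothTransition_interpolation (fun k => μ k ^ 2) R
  have hup : ∀ k, R ≤ k → μ (k + 1) ^ 2 ≤ C ^ 2 * μ k ^ 2 := by
    intro k hk
    have h0 := hμ k hk
    have h1 := hμ (k + 1) (by omega)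
    have h := (hratio k hk).1
    rw [div_le_div_iff₀ hC0 h1] at h
    rw [← mul_pow]
    exact pow_le_pow_left₀ h1.le (by linarith) 2
  have hdown : ∀ k, R ≤ k → μ k ^ 2 ≤ C ^ 2 * μ (k + 1) ^ 2 := by
    intro k hk
    have h0 := hμ k hk
    have h1 := hμ (k + 1) (by omega)
    have h := (hratio k hk).2
    rw [div_le_iff₀ h1] at h
    rw [← mul_pow]
    exact pow_le_pow_left₀ h0.le h 2
  have hlow : ∀ k : ℕ, R ≤ k → ∀ r ∈ Set.Icc (k : ℝ) ((k : ℝ) + 1),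
      1 / C ^ 2 * μ k ^ 2 ≤ w r := by
    intro k hk r hr
    rw [hwk k hk r hr, one_div_mul_eq_div, div_le_iff₀ (by positivity)]
    have ht0 := Real.smoothTransition.nonneg (r - k)
    have ht1 := Real.smoothTransition.le_one (r - k)
    have hC2 : 1 ≤ C ^ 2 := one_le_pow₀ hC
    have h1 := mul_le_mul_of_nonneg_left (hdown k hk) ht0
    have h2 : (1 - Real.smoothTransition (r - k)) * μ k ^ 2 * 1 ≤
        (1 - Real.smoothTransition (r - k)) * μ k ^ 2 * C ^ 2 :=
      mul_le_mul_of_nonneg_left hC2 (mul_nonneg (by linarith) (sq_nonneg _))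
    linarith
  have hhigh : ∀ k : ℕ, R ≤ k → ∀ r ∈ Set.Icc (k : ℝ) ((k : ℝ) + 1),
      w r ≤ μ k ^ 2 + μ (k + 1) ^ 2 := by
    intro k hk r hr
    rw [hwk k hk r hr]
    have ht0 := Real.smoothTransition.nonneg (r - k)
    have ht1 := Real.smoothTransition.le_one (r - k)
    nlinarith [mul_nonneg ht0 (sq_nonneg (μ k)),
      mul_nonneg (sub_nonneg.2 ht1) (sq_nonneg (μ (k + 1)))]
  have hpos : ∀ r : ℝ, (R : ℝ) ≤ r → 0 < w r := by
    intro r hr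
    have hk : R ≤ ⌊r⌋₊ := Nat.le_floor hr
    have h0 := hμ _ hk
    have hr0 : (0 : ℝ) ≤ r := (Nat.cast_nonneg R).trans hr
    exact lt_of_lt_of_le (by positivity)
      (hlow _ hk r ⟨Nat.floor_le hr0, (Nat.lt_floor_add_one r).le⟩)
  set ρ : ℝ → ℝ := fun r => 1 + 1 / 2 * ∫ t in (R : ℝ)..r, w t with hρ
  have hderiv : ∀ r, HasDerivAt ρ (1 / 2 * w r) r := fun r =>
    ((hw.continuous.integral_hasStrictDerivAt (R : ℝ) r).hasDerivAt.const_mul (1 / 2)).const_add 1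
  have hderiv' : deriv ρ = fun r => 1 / 2 * w r := funext fun r => (hderiv r).deriv
  have hmono : StrictMonoOn ρ (Set.Ici (R : ℝ)) := by
    refine strictMonoOn_of_deriv_pos (convex_Ici _)
      (fun r _ => (hderiv r).continuousAt.continuousWithinAt) fun r hr => ?_
    rw [interior_Ici] at hr
    rw [hderiv']
    have := hpos r (le_of_lt hr)
    positivity
  have hint : ∀ n : ℕ, ∫ t in (R : ℝ)..((R + n : ℕ) : ℝ), w t ≤
      ∑ i ∈ Finset.range n, (μ (R + i) ^ 2 + μ (R + i + 1) ^ 2) := by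
    intro n
    induction n with
    | zero => simp
    | succ n ih =>
      rw [Finset.sum_range_succ, ← intervalIntegral.integral_add_adjacent_intervals
        (hw.continuous.intervalIntegrable _ ((R + n : ℕ) : ℝ))
        (hw.continuous.intervalIntegrable _ _)]
      refine add_le_add ih ?_
      have hcast : ((R + (n + 1) : ℕ) : ℝ) = ((R + n : ℕ) : ℝ) + 1 := by push_cast; ring
      rw [hcast]
      have := intervalIntegral.integral_mono_on (μ := MeasureTheory.volume)
        (a := ((R + n : ℕ) : ℝ)) (b := ((R + n : ℕ) : ℝ) + 1)
        (by linarith) (hw.continuous.intervalIntegrable _ _)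
        (continuous_const.intervalIntegrable _ _) (hhigh (R + n) (by omega))
      simpa using this
  have hsum : ∀ m n : ℕ, ∑ i ∈ Finset.range n, μ (m + i) ^ 2 ≤ 1 := by
    intro m n
    refine le_trans ?_ hs1
    have hinj : Function.Injective fun i : ℕ => m + i := add_right_injective m
    rw [← Finset.sum_image (f := fun k => μ k ^ 2) (g := fun i => m + i) hinj.injOn]
    exact hs.sum_le_tsum _ fun i _ => sq_nonneg _
  have htotal : ∀ n : ℕ, ρ ((R + n : ℕ) : ℝ) ≤ 2 := by
    intro n
    have h1 := hint n
    have h2 := hsum R n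
    have h3 := hsum (R + 1) n
    simp only [add_right_comm R 1] at h3
    rw [Finset.sum_add_distrib] at h1
    simp only [hρ]
    linarith
  refine ⟨ρ, ?_, hmono, ?_, ?_⟩
  · rw [contDiff_infty_iff_deriv]
    refine ⟨fun r => (hderiv r).differentiableAt, ?_⟩
    rw [hderiv']
    exact contDiff_const.mul hw
  · intro r hr
    constructor
    · have : ρ R ≤ ρ r := hmono.monotoneOn Set.self_mem_Ici hr hr
      simpa [hρ] using this
    · obtain ⟨n, hn⟩ := exists_nat_ge r
      have hn' : r ≤ ((R + n : ℕ) : ℝ) := by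
        push_cast
        linarith [(Nat.cast_nonneg R : (0 : ℝ) ≤ R)]
      exact (hmono.monotoneOn hr (hr.trans hn') hn').trans (htotal n)
  · intro k hk r hr
    constructor
    · rw [hderiv']
      have := hlow k hk r hr
      calc 1 / (2 * C ^ 2) * μ k ^ 2 = 1 / 2 * (1 / C ^ 2 * μ k ^ 2) := by
            field_simp
        _ ≤ 1 / 2 * w r := by linarith
    · intro j hj
      obtain ⟨i, rfl⟩ : ∃ i, j = i + 1 := ⟨j - 1, by omega⟩
      have hb := abs_iteratedDeriv_le_of_eq_smoothTransition hw (by omega : 1 ≤ i) (hM i)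
        (hwk k hk) r hr
      have hβ : |μ (k + 1) ^ 2 - μ k ^ 2| ≤ (C ^ 2 + 1) * μ k ^ 2 := by
        rw [abs_le]
        constructor <;> nlinarith [hup k hk, sq_nonneg (μ k), sq_nonneg (μ (k + 1)),
          sq_nonneg (C * μ k)]
      have hβM := mul_le_mul_of_nonneg_right hβ (hM0 i).le
      rw [iteratedDeriv_succ', hderiv', iteratedDeriv_const_mul_field, abs_mul,
        abs_of_pos (by norm_num : (0 : ℝ) < 1 / 2)]
      have := abs_nonneg (iteratedDeriv i w r)
      calc 1 / 2 * |iteratedDeriv i w r| ≤ |iteratedDeriv i w r| := by linarith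
        _ ≤ (C ^ 2 + 1) * μ k ^ 2 * M i := hb.trans hβM
        _ = (C ^ 2 + 1) * M i * μ k ^ 2 := by ring
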